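/- Let t₀ ∈ ℝ, η > 0, c ≥ 0, h̄ ≥ 0, Φ ≥ 0, M ≥ 0, m ∈ ℕ, and delay functions h₀, …, h_m : ℝ → ℝ with 0 ≤ h_i τ ≤ h̄ for all τ and all i. Let u : ℕ → ℝ → ℝ be a family of nonnegative functions such that: (i) u 1 t ≤ Φ·exp(−η(t − t₀)) + M for all t ≥ t₀; (ii) u 1 t ≤ Φ for all t ∈ [t₀ − h̄, t₀]; (iii) u k t = 0 for all t ∈ [t₀ − h̄, t₀] and all k ≥ 2; and (iv) for every k ≥ 2 and t ≥ t₀, u k t ≤ c·∫_{t₀}^{t} exp(−η(t − τ))·( ∑_{i=0}^{m} u (k−1) (τ − h_i τ) ) dτ, the integrand being integrable on [t₀, t]. Then for every k ≥ 1 there exists a constant A ≥ 0 such that u k t ≤ A·(1 + (t − t₀))^{k−1}·exp(−η(t − t₀)) + (c·(m+1)/η)^{k−1}·M for all t ≥ t₀. -/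

import Mathlib

/-- A bound of polynomial times exponential type on `[t₀, ∞)`, together with a constant bound on the
history interval, survives a bounded delay up to enlarging the constant. -/
lemma exists_delayed_poly_mul_exp_bound {t₀ η r Φ N A : ℝ} {n : ℕ} {v : ℝ → ℝ}
    (hη : 0 < η) (hΦ : 0 ≤ Φ) (hN : 0 ≤ N) (hA : 0 ≤ A)
    (hv : ∀ t, t₀ ≤ t → v t ≤ A * (1 + (t - t₀)) ^ n * Real.exp (-η * (t - t₀)) + N)
    (hhist : ∀ t, t₀ - r ≤ t → t ≤ t₀ → v t ≤ Φ) :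
    ∃ B, 0 ≤ B ∧ ∀ τ, t₀ ≤ τ → ∀ d, 0 ≤ d → d ≤ r →
      v (τ - d) ≤ B * (1 + (τ - t₀)) ^ n * Real.exp (-η * (τ - t₀)) + N := by
  refine ⟨(A + Φ) * Real.exp (η * r), by positivity, fun τ hτ d hd hdr => ?_⟩
  have hpos : 0 ≤ τ - t₀ := sub_nonneg.2 hτ
  have hpow : 1 ≤ (1 + (τ - t₀)) ^ n := one_le_pow₀ (by linarith)
  have hexp : Real.exp (η * r) * Real.exp (-η * (τ - t₀)) = Real.exp (η * (r - (τ - t₀))) := by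
    rw [← Real.exp_add]
    ring_nf
  have hsplit : (A + Φ) * Real.exp (η * r) * (1 + (τ - t₀)) ^ n * Real.exp (-η * (τ - t₀)) =
      A * (1 + (τ - t₀)) ^ n * Real.exp (η * (r - (τ - t₀))) +
        Φ * ((1 + (τ - t₀)) ^ n * Real.exp (η * (r - (τ - t₀)))) := by
    rw [← hexp]
    ring
  rw [hsplit]
  rcases le_total t₀ (τ - d) with hs | hs
  · have hle : A * (1 + (τ - d - t₀)) ^ n * Real.exp (-η * (τ - d - t₀)) ≤
        A * (1 + (τ - t₀)) ^ n * Real.exp (η * (r - (τ - t₀))) := by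
      have h0 : 0 ≤ τ - d - t₀ := sub_nonneg.2 hs
      have he : -η * (τ - d - t₀) ≤ η * (r - (τ - t₀)) := by nlinarith
      gcongr
      linarith
    have h2 : 0 ≤ Φ * ((1 + (τ - t₀)) ^ n * Real.exp (η * (r - (τ - t₀)))) := by positivity
    linarith [hv _ hs]
  · have he : 1 ≤ Real.exp (η * (r - (τ - t₀))) :=
      Real.one_le_exp (mul_nonneg hη.le (by linarith))
    have h1 : Φ * 1 ≤ Φ * ((1 + (τ - t₀)) ^ n * Real.exp (η * (r - (τ - t₀)))) :=
      mul_le_mul_of_nonneg_left (one_le_mul_of_one_le_of_one_le hpow he) hΦ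
    have h2 : 0 ≤ A * (1 + (τ - t₀)) ^ n * Real.exp (η * (r - (τ - t₀))) := by positivity
    linarith [hhist (τ - d) (by linarith) hs]

/-- The integral of a constant plus an exponential kernel. -/
lemma integral_const_add_mul_exp_kernel {η : ℝ} (hη : η ≠ 0) (K L a t : ℝ) :
    ∫ τ in a..t, (K + L * Real.exp (-η * (t - τ))) =
      K * (t - a) + L * (1 - Real.exp (-η * (t - a))) / η := by
  have hderiv : ∀ τ ∈ Set.uIcc a t, HasDerivAt
      (fun τ => K * τ + L * Real.exp (-η * (t - τ)) / η)
      (K + L * Real.exp (-η * (t - τ))) τ := by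
    intro τ _
    have h1 : HasDerivAt (fun τ => -η * (t - τ)) (-η * (-1)) τ :=
      ((hasDerivAt_id τ).const_sub t).const_mul (-η)
    refine (((hasDerivAt_id τ).const_mul K).add
      ((h1.exp.const_mul L).div_const η)).congr_deriv ?_
    field_simp
  rw [intervalIntegral.integral_eq_sub_of_hasDerivAt hderiv
    (Continuous.intervalIntegrable (by fun_prop) _ _)]
  simp only [sub_self, mul_zero, Real.exp_zero]
  ring

/-- Abstract comparison form of Theorem 1: nonnegative functions `u k` satisfying the base
bounds (i)–(ii), the zero history condition (iii) and the integral recursion (iv) obey, for every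
`k ≥ 1`, a bound by a degree-`(k−1)` polynomial in `(t − t₀)` times `exp(−η(t − t₀))` plus the
term `(c(m+1)/η)^{k−1} M`. -/
theorem successive_approximation_polynomial_bound
    (t₀ η c hbar Φ M : ℝ) (hη : 0 < η) (hc : 0 ≤ c) (hhbar : 0 ≤ hbar)
    (hΦ : 0 ≤ Φ) (hM : 0 ≤ M)
    (m : ℕ) (h : Fin (m + 1) → ℝ → ℝ) (hh : ∀ i τ, 0 ≤ h i τ ∧ h i τ ≤ hbar)
    (u : ℕ → ℝ → ℝ) (hu : ∀ k t, 0 ≤ u k t)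
    (hu1 : ∀ t : ℝ, t₀ ≤ t → u 1 t ≤ Φ * Real.exp (-η * (t - t₀)) + M)
    (hu1hist : ∀ t : ℝ, t₀ - hbar ≤ t → t ≤ t₀ → u 1 t ≤ Φ)
    (huhist : ∀ k : ℕ, 2 ≤ k → ∀ t : ℝ, t₀ - hbar ≤ t → t ≤ t₀ → u k t = 0)
    (hint : ∀ k : ℕ, 2 ≤ k → ∀ t : ℝ, t₀ ≤ t →
      IntervalIntegrable
        (fun τ => Real.exp (-η * (t - τ)) * ∑ i : Fin (m + 1), u (k - 1) (τ - h i τ))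
        MeasureTheory.volume t₀ t)
    (hrec : ∀ k : ℕ, 2 ≤ k → ∀ t : ℝ, t₀ ≤ t →
      u k t ≤ c * ∫ τ in t₀..t,
        Real.exp (-η * (t - τ)) * ∑ i : Fin (m + 1), u (k - 1) (τ - h i τ)) :
    ∀ k : ℕ, 1 ≤ k → ∃ A : ℝ, 0 ≤ A ∧ ∀ t : ℝ, t₀ ≤ t →
      u k t ≤ A * (1 + (t - t₀)) ^ (k - 1) * Real.exp (-η * (t - t₀)) +
        (c * (m + 1) / η) ^ (k - 1) * M := by
  intro k hk
  induction k, hk using Nat.le_induction with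
  | base => exact ⟨Φ, hΦ, fun t ht => by simpa using hu1 t ht⟩
  | succ k hk ih =>
    obtain ⟨A, hA, hbound⟩ := ih
    have hhist : ∀ t, t₀ - hbar ≤ t → t ≤ t₀ → u k t ≤ Φ := by
      intro t h1 h2
      rcases hk.eq_or_lt with rfl | hk2
      · exact hu1hist t h1 h2
      · exact (huhist k hk2 t h1 h2).trans_le hΦ
    obtain ⟨n, rfl⟩ : ∃ n, k = n + 1 := ⟨k - 1, by omega⟩
    simp only [Nat.add_sub_cancel] at hbound ⊢
    set N := (c * (m + 1) / η) ^ n * M with hN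
    have hN0 : 0 ≤ N := by positivity
    obtain ⟨B, hB, hdelay⟩ :=
      exists_delayed_poly_mul_exp_bound hη hΦ hN0 hA hbound hhist
    refine ⟨c * ((m + 1) * B), by positivity, fun t ht => ?_⟩
    have hrec' := hrec (n + 1 + 1) (by omega) t ht
    have hint' := hint (n + 1 + 1) (by omega) t ht
    simp only [Nat.add_sub_cancel] at hrec' hint'
    have hpos : 0 ≤ t - t₀ := sub_nonneg.2 ht
    set E := Real.exp (-η * (t - t₀)) with hE
    have hE0 : 0 < E := Real.exp_pos _
    have hmono :
        ∫ τ in t₀..t, Real.exp (-η * (t - τ)) * ∑ i : Fin (m + 1), u (n + 1) (τ - h i τ) ≤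
        ∫ τ in t₀..t, ((m + 1) * B * (1 + (t - t₀)) ^ n * E +
          (m + 1) * N * Real.exp (-η * (t - τ))) := by
      refine intervalIntegral.integral_mono_on ht hint'
        (Continuous.intervalIntegrable (by fun_prop) _ _) fun τ hτ => ?_
      have hτ0 : 0 ≤ τ - t₀ := sub_nonneg.2 hτ.1
      have hsum : ∑ i : Fin (m + 1), u (n + 1) (τ - h i τ) ≤
          (m + 1) * (B * (1 + (τ - t₀)) ^ n * Real.exp (-η * (τ - t₀)) + N) := by
        refine (Finset.sum_le_sum fun i _ =>
          hdelay τ hτ.1 (h i τ) (hh i τ).1 (hh i τ).2).trans_eq ?_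
        simp only [Finset.sum_const, Finset.card_univ, Fintype.card_fin, nsmul_eq_mul,
          Nat.cast_add, Nat.cast_one]
      have hexp : Real.exp (-η * (t - τ)) * Real.exp (-η * (τ - t₀)) = E := by
        rw [← Real.exp_add, hE]
        ring_nf
      calc Real.exp (-η * (t - τ)) * ∑ i : Fin (m + 1), u (n + 1) (τ - h i τ)
          ≤ Real.exp (-η * (t - τ)) *
              ((m + 1) * (B * (1 + (τ - t₀)) ^ n * Real.exp (-η * (τ - t₀)) + N)) := by gcongr
        _ = (m + 1) * B * (1 + (τ - t₀)) ^ n * E + (m + 1) * N * Real.exp (-η * (t - τ)) := by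
            rw [← hexp]
            ring
        _ ≤ (m + 1) * B * (1 + (t - t₀)) ^ n * E + (m + 1) * N * Real.exp (-η * (t - τ)) := by
            gcongr
            exact hτ.2
    rw [integral_const_add_mul_exp_kernel hη.ne'] at hmono
    calc u (n + 1 + 1) t
        ≤ c * ((m + 1) * B * (1 + (t - t₀)) ^ n * E * (t - t₀) + (m + 1) * N * (1 - E) / η) :=
          hrec'.trans (mul_le_mul_of_nonneg_left hmono hc)
      _ ≤ c * ((m + 1) * B * (1 + (t - t₀)) ^ n * E * (1 + (t - t₀)) + (m + 1) * N * 1 / η) := by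
          gcongr <;> linarith
      _ = c * ((m + 1) * B) * (1 + (t - t₀)) ^ (n + 1) * E +
            (c * (m + 1) / η) ^ (n + 1) * M := by
          rw [hN]
          ring
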